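/- Let k be a field of characteristic zero. For i = 1, 2, let Vᵢ be a k-vector space with an alternating bilinear form ⟨·,·⟩ᵢ and let ρᵢ : Gᵢ → GL(Vᵢ) be a nontrivial irreducible representation of a group Gᵢ such that Gᵢ is generated by elements acting as transvections α ↦ α − ⟨α, δ⟩ᵢ·δ for vectors δ ∈ Vᵢ. Consider the componentwise action of G = G₁ × G₂ on V₁ × V₂, and let Γ be a finite-index subgroup of G. Then every Γ-invariant k-subspace of V₁ × V₂ is one of: {0}, V₁ × {0}, {0} × V₂, or V₁ × V₂. -/

import Mathlib

/-- The powers of a transvection are `α ↦ α - n ⟨α, δ⟩ δ`. -/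
lemma Representation.pow_apply_of_transvection {k G V : Type*} [Field k] [Group G]
    [AddCommGroup V] [Module k V] (B : V →ₗ[k] V →ₗ[k] k) (hB : ∀ v, B v v = 0)
    (ρ : Representation k G V) {s : G} {δ : V} (hs : ∀ α, ρ s α = α - B α δ • δ)
    (n : ℕ) (α : V) : ρ (s ^ n) α = α - ((n : k) * B α δ) • δ := by
  induction n with
  | zero => simp
  | succ n ih =>
    rw [pow_succ', map_mul, Module.End.mul_apply, ih, hs]
    simp only [map_sub, map_smul, LinearMap.sub_apply, LinearMap.smul_apply, hB, smul_zero,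
      sub_zero, Nat.cast_succ]
    module

/-- The inverse of a transvection is `α ↦ α + ⟨α, δ⟩ δ`. -/
lemma Representation.inv_apply_of_transvection {k G V : Type*} [Field k] [Group G]
    [AddCommGroup V] [Module k V] (B : V →ₗ[k] V →ₗ[k] k) (hB : ∀ v, B v v = 0)
    (ρ : Representation k G V) {s : G} {δ : V} (hs : ∀ α, ρ s α = α - B α δ • δ)
    (α : V) : ρ s⁻¹ α = α + B α δ • δ := by
  have h : ρ s (α + B α δ • δ) = α := by
    rw [hs]
    simp [hB]
  calc ρ s⁻¹ α = ρ s⁻¹ (ρ s (α + B α δ • δ)) := by rw [h]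
    _ = α + B α δ • δ := by simp

/-- Let `V` be a direct summand of `M`, with inclusion `i` and projection `π`, and let `G` act on
`M` through its action on `V`. If `G` is generated by transvections each of which has a positive
power stabilizing `W ≤ M`, then `G` stabilizes `W`. -/
lemma Representation.stabilizes_of_transvection_pow {k G V M : Type*} [Field k] [CharZero k]
    [Group G] [AddCommGroup V] [Module k V] [AddCommGroup M] [Module k M]
    (B : V →ₗ[k] V →ₗ[k] k) (hB : ∀ v, B v v = 0) (ρ : Representation k G V)
    {S : Set G} (hS : Subgroup.closure S = ⊤)
    (htrans : ∀ s ∈ S, ∃ δ : V, ∀ α : V, ρ s α = α - B α δ • δ)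
    (i : V →ₗ[k] M) (π : M →ₗ[k] V) (hπ : ∀ v, π (i v) = v) (W : Submodule k M)
    (hpow : ∀ s ∈ S, ∃ n : ℕ, n ≠ 0 ∧ ∀ p ∈ W, i (ρ (s ^ n) (π p) - π p) ∈ W)
    (g : G) : ∀ p ∈ W, i (ρ g (π p) - π p) ∈ W := by
  have key : ∀ s ∈ S, ∃ δ : V, (∀ α : V, ρ s α = α - B α δ • δ) ∧
      ∀ p ∈ W, i (B (π p) δ • δ) ∈ W := by
    intro s hs
    obtain ⟨δ, hδ⟩ := htrans s hs
    obtain ⟨n, hn, h⟩ := hpow s hs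
    refine ⟨δ, hδ, fun p hp => ?_⟩
    have hn' : (-(n : k)) ≠ 0 := neg_ne_zero.mpr (Nat.cast_ne_zero.mpr hn)
    rw [← W.smul_mem_iff hn', ← map_smul]
    convert h p hp using 2
    rw [ρ.pow_apply_of_transvection B hB hδ]
    module
  have hg : g ∈ Subgroup.closure S := hS ▸ Subgroup.mem_top g
  induction hg using Subgroup.closure_induction'' with
  | mem s hs =>
    intro p hp
    obtain ⟨δ, hδ, h⟩ := key s hs
    simpa [hδ] using W.neg_mem (h p hp)
  | inv_mem s hs =>
    intro p hp
    obtain ⟨δ, hδ, h⟩ := key s hs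
    simpa [ρ.inv_apply_of_transvection B hB hδ] using h p hp
  | one => simp
  | mul a b _ _ iha ihb =>
    intro p hp
    have hb := ihb p hp
    have ha := iha _ (W.add_mem hp hb)
    convert W.add_mem ha hb using 1
    simp [hπ]

/-- A nontrivial irreducible representation has no nonzero fixed vector. -/
lemma Representation.eq_zero_of_forall_apply_eq {k G V : Type*} [Field k] [Group G]
    [AddCommGroup V] [Module k V] (ρ : Representation k G V)
    (hirr : ∀ W : Submodule k V, (∀ g : G, ∀ v ∈ W, ρ g v ∈ W) → W = ⊥ ∨ W = ⊤)
    (hnontriv : ∃ (g : G) (v : V), ρ g v ≠ v) {v : V} (hv : ∀ g, ρ g v = v) : v = 0 := by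
  rcases hirr ρ.invariants fun g w hw => by rwa [(ρ.mem_invariants w).mp hw g] with h | h
  · rw [← Submodule.mem_bot k, ← h]
    exact (ρ.mem_invariants v).mpr hv
  · obtain ⟨g, w, hw⟩ := hnontriv
    exact absurd ((ρ.mem_invariants w).mp (h ▸ Submodule.mem_top) g) hw

/-- Char-zero combination: if `Gᵢ` acts irreducibly and nontrivially on `Vᵢ`, generated
by transvections for an alternating form, and `Γ` is a finite-index subgroup of
`G₁ × G₂`, then the only `Γ`-invariant subspaces of `V₁ × V₂` are `{0}`, `V₁ × {0}`,
`{0} × V₂` and `V₁ × V₂`. -/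
theorem stmt6 (k : Type*) [Field k] [CharZero k]
    (G₁ G₂ : Type*) [Group G₁] [Group G₂]
    (V₁ V₂ : Type*) [AddCommGroup V₁] [Module k V₁] [AddCommGroup V₂] [Module k V₂]
    (B₁ : V₁ →ₗ[k] V₁ →ₗ[k] k) (hB₁ : ∀ v : V₁, B₁ v v = 0)
    (B₂ : V₂ →ₗ[k] V₂ →ₗ[k] k) (hB₂ : ∀ v : V₂, B₂ v v = 0)
    (ρ₁ : Representation k G₁ V₁) (ρ₂ : Representation k G₂ V₂)
    (hirr₁ : ∀ W : Submodule k V₁, (∀ g : G₁, ∀ v ∈ W, ρ₁ g v ∈ W) → W = ⊥ ∨ W = ⊤)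
    (hirr₂ : ∀ W : Submodule k V₂, (∀ g : G₂, ∀ v ∈ W, ρ₂ g v ∈ W) → W = ⊥ ∨ W = ⊤)
    (hnontriv₁ : ∃ (g : G₁) (v : V₁), ρ₁ g v ≠ v)
    (hnontriv₂ : ∃ (g : G₂) (v : V₂), ρ₂ g v ≠ v)
    (S₁ : Set G₁) (hS₁ : Subgroup.closure S₁ = ⊤)
    (htrans₁ : ∀ s ∈ S₁, ∃ δ : V₁, ∀ α : V₁, ρ₁ s α = α - B₁ α δ • δ)
    (S₂ : Set G₂) (hS₂ : Subgroup.closure S₂ = ⊤)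
    (htrans₂ : ∀ s ∈ S₂, ∃ δ : V₂, ∀ α : V₂, ρ₂ s α = α - B₂ α δ • δ)
    (Γ : Subgroup (G₁ × G₂)) [Γ.FiniteIndex]
    (W : Submodule k (V₁ × V₂))
    (hW : ∀ γ ∈ Γ, ∀ p ∈ W, (ρ₁ γ.1 p.1, ρ₂ γ.2 p.2) ∈ W) :
    W = ⊥ ∨ W = (⊤ : Submodule k V₁).prod (⊥ : Submodule k V₂) ∨
      W = (⊥ : Submodule k V₁).prod (⊤ : Submodule k V₂) ∨ W = ⊤ := by
  have hinv₁ : ∀ g, ∀ p ∈ W, ((ρ₁ g p.1 - p.1, 0) : V₁ × V₂) ∈ W := fun g =>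
    ρ₁.stabilizes_of_transvection_pow B₁ hB₁ hS₁ htrans₁ (LinearMap.inl k V₁ V₂)
      (LinearMap.fst k V₁ V₂) (fun _ => rfl) W (fun s _ => by
        obtain ⟨n, hn, -, h⟩ := Γ.exists_pow_mem_of_index_ne_zero
          Subgroup.FiniteIndex.index_ne_zero ((s, 1) : G₁ × G₂)
        refine ⟨n, hn.ne', fun p hp => ?_⟩
        simpa [Prod.sub_def] using W.sub_mem (hW _ h p hp) hp) g
  have hinv₂ : ∀ g, ∀ p ∈ W, ((0, ρ₂ g p.2 - p.2) : V₁ × V₂) ∈ W := fun g =>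
    ρ₂.stabilizes_of_transvection_pow B₂ hB₂ hS₂ htrans₂ (LinearMap.inr k V₁ V₂)
      (LinearMap.snd k V₁ V₂) (fun _ => rfl) W (fun s _ => by
        obtain ⟨n, hn, -, h⟩ := Γ.exists_pow_mem_of_index_ne_zero
          Subgroup.FiniteIndex.index_ne_zero ((1, s) : G₁ × G₂)
        refine ⟨n, hn.ne', fun p hp => ?_⟩
        simpa [Prod.sub_def] using W.sub_mem (hW _ h p hp) hp) g
  have h₁ := hirr₁ (W.comap (LinearMap.inl k V₁ V₂)) fun g v hv => by
    simpa using W.add_mem (hinv₁ g _ hv) hv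
  have h₂ := hirr₂ (W.comap (LinearMap.inr k V₁ V₂)) fun g v hv => by
    simpa using W.add_mem (hinv₂ g _ hv) hv
  have hbot₁ (h : W.comap (LinearMap.inl k V₁ V₂) = ⊥) (p) (hp : p ∈ W) : p.1 = 0 :=
    ρ₁.eq_zero_of_forall_apply_eq hirr₁ hnontriv₁ fun g => by
      rw [← sub_eq_zero, ← Submodule.mem_bot k, ← h]
      exact hinv₁ g p hp
  have hbot₂ (h : W.comap (LinearMap.inr k V₁ V₂) = ⊥) (p) (hp : p ∈ W) : p.2 = 0 :=
    ρ₂.eq_zero_of_forall_apply_eq hirr₂ hnontriv₂ fun g => by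
      rw [← sub_eq_zero, ← Submodule.mem_bot k, ← h]
      exact hinv₂ g p hp
  have htop₁ (h : W.comap (LinearMap.inl k V₁ V₂) = ⊤) (v : V₁) : ((v, 0) : V₁ × V₂) ∈ W :=
    (h ▸ Submodule.mem_top : v ∈ W.comap (LinearMap.inl k V₁ V₂))
  have htop₂ (h : W.comap (LinearMap.inr k V₁ V₂) = ⊤) (v : V₂) : ((0, v) : V₁ × V₂) ∈ W :=
    (h ▸ Submodule.mem_top : v ∈ W.comap (LinearMap.inr k V₁ V₂))
  rcases h₁ with h₁ | h₁ <;> rcases h₂ with h₂ | h₂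
  · exact .inl <| (Submodule.eq_bot_iff W).mpr fun p hp =>
      Prod.ext (hbot₁ h₁ p hp) (hbot₂ h₂ p hp)
  · refine .inr <| .inr <| .inl <| le_antisymm (fun p hp => ⟨hbot₁ h₁ p hp, trivial⟩) ?_
    rintro ⟨v, w⟩ ⟨hv, -⟩
    obtain rfl : v = 0 := hv
    exact htop₂ h₂ w
  · refine .inr <| .inl <| le_antisymm (fun p hp => ⟨trivial, hbot₂ h₂ p hp⟩) ?_
    rintro ⟨v, w⟩ ⟨-, hw⟩
    obtain rfl : w = 0 := hw
    exact htop₁ h₁ v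
  · refine .inr <| .inr <| .inr <| (Submodule.eq_top_iff').mpr fun p => ?_
    simpa using W.add_mem (htop₁ h₁ p.1) (htop₂ h₂ p.2)
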